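/- Every non-trivial graph G has a T-partition of width at most 2·(tw(G)+1)·(9·Δ(G) − 1) for some tree T with maximum degree Δ(T) ≤ 6·Δ(G). -/

import Mathlib

open SimpleGraph

/-- The maximum degree of a finite simple graph `G`:
the supremum of the numbers of neighbours of its vertices. -/
noncomputable def maxDeg {V : Type*} [Fintype V] (G : SimpleGraph V) : ℕ :=
  sSup (Set.range fun v => (G.neighborSet v).ncard)

/-- `B` is a `T`-partition of the graph `G`: the tree `T` indexes a partition
`(B x : x ∈ V(T))` of `V(G)` such that for every edge `vw` of `G`, if `v ∈ B x` and
`w ∈ B y` then `x = y` or `xy ∈ E(T)`. -/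
structure IsTreePartition {V ι : Type*} (G : SimpleGraph V) (T : SimpleGraph ι)
    (B : ι → Set V) : Prop where
  /-- `T` is a tree. -/
  isTree : T.IsTree
  /-- the parts are nonempty -/
  part_nonempty : ∀ x, (B x).Nonempty
  /-- every vertex of `G` lies in exactly one part -/
  part_existsUnique : ∀ v, ∃! x, v ∈ B x
  /-- parts containing adjacent vertices are equal or adjacent in `T` -/
  part_adj : ∀ ⦃v w x y⦄, G.Adj v w → v ∈ B x → w ∈ B y → x = y ∨ T.Adj x y

/-- `B` is a tree-decomposition of the graph `G` over the tree `T`: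
every edge of `G` has both ends in a common bag, and for each vertex `v` of `G`
the set of nodes whose bag contains `v` induces a non-empty subtree of `T`. -/
structure IsTreeDecomp {V ι : Type*} (G : SimpleGraph V) (T : SimpleGraph ι)
    (B : ι → Set V) : Prop where
  /-- `T` is a tree. -/
  isTree : T.IsTree
  /-- every edge of `G` lies in some bag -/
  edge_mem : ∀ ⦃u v⦄, G.Adj u v → ∃ x, u ∈ B x ∧ v ∈ B x
  /-- the bags containing a given vertex induce a non-empty subtree -/
  subtree : ∀ v, (T.induce {x | v ∈ B x}).Connected

/-- The treewidth of a finite graph: the minimum, over tree-decompositions,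
of the maximum bag size minus one. -/
noncomputable def treewidth {V : Type} [Fintype V] (G : SimpleGraph V) : ℕ :=
  sInf {k | ∃ (ι : Type) (_ : Fintype ι) (T : SimpleGraph ι) (B : ι → Set V),
    IsTreeDecomp G T B ∧ ∀ x, (B x).ncard ≤ k + 1}

/-- The tree-partition-width of a finite graph: the minimum width of a tree-partition. -/
noncomputable def tpw {V : Type} [Fintype V] (G : SimpleGraph V) : ℕ :=
  sInf {k | ∃ (ι : Type) (_ : Fintype ι) (T : SimpleGraph ι) (B : ι → Set V),
    IsTreePartition G T B ∧ ∀ x, (B x).ncard ≤ k}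

/-- A partition of the vertex set `W` indexed by the rooted tree on `Option ι` whose root is `none`
and in which `p x` is the parent of `some x`. The function `c` assigns to each vertex its part.
Non-root parts are non-empty and have at most `w` vertices, and non-root nodes have fewer than `D`
children. -/
structure IsRootedPartition {V ι : Type*} (G : SimpleGraph V) (W : Set V) (p : ι → Option ι)
    (c : V → Option ι) (w D : ℕ) : Prop where
  rank : ∃ h : ι → ℕ, ∀ x y, p x = some y → h y < h x
  part_nonempty : ∀ x, ∃ v ∈ W, c v = some x
  part_ncard_le : ∀ x, {v | v ∈ W ∧ c v = some x}.ncard ≤ w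
  children_ncard_lt : ∀ x, {y | p y = some x}.ncard + 1 ≤ D
  part_adj : ∀ u ∈ W, ∀ v ∈ W, G.Adj u v →
    c u = c v ∨ (∃ x, c u = some x ∧ p x = c v) ∨ (∃ x, c v = some x ∧ p x = c u)

/-- The graph on `Option ι` joining each `some x` to its parent `p x`. -/
def parentGraph {ι : Type*} (p : ι → Option ι) : SimpleGraph (Option ι) :=
  SimpleGraph.fromRel fun a b => ∃ x, a = some x ∧ p x = b

theorem parentGraph_adj {ι : Type*} {p : ι → Option ι} {a b : Option ι} :
    (parentGraph p).Adj a b ↔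
      a ≠ b ∧ ((∃ x, a = some x ∧ p x = b) ∨ ∃ x, b = some x ∧ p x = a) :=
  Iff.rfl

theorem parentGraph_isTree {ι : Type*} [Fintype ι] {p : ι → Option ι} {h : ι → ℕ}
    (hp : ∀ x y, p x = some y → h y < h x) : (parentGraph p).IsTree := by
  classical
  have hne : ∀ x, some x ≠ p x := fun x hx => lt_irrefl _ (hp x x hx.symm)
  have hadj : ∀ x, (parentGraph p).Adj (some x) (p x) := fun x =>
    parentGraph_adj.2 ⟨hne x, Or.inl ⟨x, rfl, rfl⟩⟩
  have hreach : ∀ n x, h x < n → (parentGraph p).Reachable (some x) none := by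
    intro n
    induction n with
    | zero => intro x hx; omega
    | succ n ih =>
      intro x hx
      refine (hadj x).reachable.trans ?_
      cases hpx : p x with
      | none => exact Reachable.refl _
      | some y => exact ih y (by have := hp x y hpx; omega)
  have hroot : ∀ a, (parentGraph p).Reachable a none := by
    intro a
    cases a with
    | none => exact Reachable.refl _
    | some x => exact hreach _ x (Nat.lt_succ_self _)
  have hconn : (parentGraph p).Connected :=
    { preconnected := fun a b => (hroot a).trans (hroot b).symm, nonempty := ⟨none⟩ }
  rw [isTree_iff_connected_and_card]
  refine ⟨hconn, le_antisymm ?_ hconn.card_vert_le_card_edgeSet_add_one⟩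
  have hsurj : Function.Surjective
      (fun x : ι => (⟨s(some x, p x), hadj x⟩ : (parentGraph p).edgeSet)) := by
    rintro ⟨e, he⟩
    induction e using Sym2.ind with
    | _ a b =>
      rcases parentGraph_adj.1 he with ⟨-, ⟨x, rfl, rfl⟩ | ⟨x, rfl, rfl⟩⟩
      · exact ⟨x, rfl⟩
      · exact ⟨x, Subtype.ext Sym2.eq_swap⟩
  have := Nat.card_le_card_of_surjective _ hsurj
  rw [Finite.card_option]
  exact Nat.add_le_add_right this 1

theorem IsRootedPartition.exists_treePartition {V ι : Type} [Finite V] [Fintype ι]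
    {G : SimpleGraph V} {p : ι → Option ι} {c : V → Option ι} {w D : ℕ}
    (hP : IsRootedPartition G Set.univ p c w D) (hroot : ∃ v, c v = none)
    (hrootw : {v | c v = none}.ncard ≤ w) (hrootD : {y | p y = none}.ncard ≤ D) :
    ∃ (κ : Type) (_ : Fintype κ) (T : SimpleGraph κ) (B : κ → Set V),
      IsTreePartition G T B ∧ (∀ x, (B x).ncard ≤ w) ∧
      (∀ x, (T.neighborSet x).ncard ≤ D) := by
  obtain ⟨h, hp⟩ := hP.rank
  refine ⟨Option ι, inferInstance, parentGraph p, fun a => {v | c v = a},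
    ⟨parentGraph_isTree hp, ?_, ?_, ?_⟩, ?_, ?_⟩
  · rintro (_ | x)
    · exact hroot
    · obtain ⟨v, -, hv⟩ := hP.part_nonempty x
      exact ⟨v, hv⟩
  · exact fun v => ⟨c v, rfl, fun y hy => hy.symm⟩
  · rintro v u _ _ hvu rfl rfl
    by_cases he : c v = c u
    · exact Or.inl he
    · exact Or.inr (parentGraph_adj.2
        ⟨he, (hP.part_adj v trivial u trivial hvu).resolve_left he⟩)
  · rintro (_ | x)
    · exact hrootw
    · simpa using hP.part_ncard_le x
  · rintro (_ | x)
    · refine le_trans (le_trans (Set.ncard_le_ncard (t := some '' {y | p y = none}) ?_)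
        (Set.ncard_image_le (Set.toFinite _))) hrootD
      intro b hb
      rcases parentGraph_adj.1 hb with ⟨-, ⟨x, hx, -⟩ | ⟨x, rfl, hx⟩⟩
      · cases hx
      · exact ⟨x, hx, rfl⟩
    · refine le_trans (le_trans
        (Set.ncard_le_ncard (t := insert (p x) (some '' {y | p y = some x})) ?_)
        ((Set.ncard_insert_le _ _).trans
          (Nat.add_le_add_right (Set.ncard_image_le (Set.toFinite _)) 1)))
        (hP.children_ncard_lt x)
      intro b hb
      rcases parentGraph_adj.1 hb with ⟨-, ⟨y, hy, hb⟩ | ⟨y, rfl, hy⟩⟩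
      · cases hy
        exact Or.inl hb.symm
      · exact Or.inr ⟨y, hy, rfl⟩

theorem isRootedPartition_of_isEmpty {V ι : Type*} [IsEmpty ι] (G : SimpleGraph V) (W : Set V)
    (p : ι → Option ι) (c : V → Option ι) (w D : ℕ) : IsRootedPartition G W p c w D where
  rank := ⟨fun _ => 0, fun x => isEmptyElim x⟩
  part_nonempty := fun x => isEmptyElim x
  part_ncard_le := fun x => isEmptyElim x
  children_ncard_lt := fun x => isEmptyElim x
  part_adj := fun _ _ _ _ _ => Or.inl (Subsingleton.elim _ _)

/-- The vertex set of `G` splits as `X ∪ A₁ ∪ A₂` with no edge between `A₁` and `A₂`, where `X` has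
at most `k` vertices and neither `A₁` nor `A₂` contains more than two thirds of `S`. -/
def HasBalancedSeparation {V : Type*} (G : SimpleGraph V) (k : ℕ) (S : Set V) : Prop :=
  ∃ X A₁ A₂ : Set V, X.ncard ≤ k ∧ (∀ v, v ∈ X ∨ v ∈ A₁ ∨ v ∈ A₂) ∧
    Disjoint X A₁ ∧ Disjoint X A₂ ∧ Disjoint A₁ A₂ ∧
    (∀ u ∈ A₁, ∀ v ∈ A₂, ¬ G.Adj u v) ∧
    3 * (S ∩ A₁).ncard ≤ 2 * S.ncard ∧ 3 * (S ∩ A₂).ncard ≤ 2 * S.ncard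

/-- Two rooted partitions whose vertex sets overlap only in their root parts can be glued along the
roots. -/
theorem IsRootedPartition.glue {V ι₁ ι₂ : Type*} [Finite V] [Finite ι₁] [Finite ι₂]
    {G : SimpleGraph V} {W W₁ W₂ : Set V} {p₁ : ι₁ → Option ι₁} {p₂ : ι₂ → Option ι₂}
    {c₁ : V → Option ι₁} {c₂ : V → Option ι₂} {w D : ℕ}
    (h₁ : IsRootedPartition G W₁ p₁ c₁ w D) (h₂ : IsRootedPartition G W₂ p₂ c₂ w D)
    (hW : W = W₁ ∪ W₂) (hX₁ : ∀ v ∈ W₁ ∩ W₂, c₁ v = none) (hX₂ : ∀ v ∈ W₁ ∩ W₂, c₂ v = none)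
    (hadj : ∀ u ∈ W, ∀ v ∈ W, G.Adj u v → (u ∈ W₁ ∧ v ∈ W₁) ∨ (u ∈ W₂ ∧ v ∈ W₂)) :
    ∃ (p : ι₁ ⊕ ι₂ → Option (ι₁ ⊕ ι₂)) (c : V → Option (ι₁ ⊕ ι₂)),
      IsRootedPartition G W p c w D ∧
      (∀ v ∈ W₁, c v = (c₁ v).map Sum.inl) ∧ (∀ v ∈ W₂, c v = (c₂ v).map Sum.inr) ∧
      {y | p y = none}.ncard ≤ {y | p₁ y = none}.ncard + {y | p₂ y = none}.ncard := by
  classical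
  obtain ⟨r₁, hr₁⟩ := h₁.rank
  obtain ⟨r₂, hr₂⟩ := h₂.rank
  let p : ι₁ ⊕ ι₂ → Option (ι₁ ⊕ ι₂) :=
    Sum.elim (fun x => (p₁ x).map Sum.inl) (fun x => (p₂ x).map Sum.inr)
  let c : V → Option (ι₁ ⊕ ι₂) :=
    fun v => if v ∈ W₁ then (c₁ v).map Sum.inl else (c₂ v).map Sum.inr
  have hc₁ : ∀ v ∈ W₁, c v = (c₁ v).map Sum.inl := fun v hv => if_pos hv
  have hc₂ : ∀ v ∈ W₂, c v = (c₂ v).map Sum.inr := by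
    intro v hv
    by_cases hv₁ : v ∈ W₁
    · rw [hc₁ v hv₁, hX₁ v ⟨hv₁, hv⟩, hX₂ v ⟨hv₁, hv⟩]
      rfl
    · exact if_neg hv₁
  subst hW
  refine ⟨p, c, ⟨⟨Sum.elim r₁ r₂, ?_⟩, ?_, ?_, ?_, ?_⟩, hc₁, hc₂, ?_⟩
  · rintro (x | x) (y | y) hxy <;> simp [p] at hxy
    · exact hr₁ x y hxy
    · exact hr₂ x y hxy
  · rintro (x | x)
    · obtain ⟨v, hv, hvx⟩ := h₁.part_nonempty x
      exact ⟨v, Or.inl hv, by simp [hc₁ v hv, hvx]⟩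
    · obtain ⟨v, hv, hvx⟩ := h₂.part_nonempty x
      exact ⟨v, Or.inr hv, by simp [hc₂ v hv, hvx]⟩
  · rintro (x | x)
    · refine le_trans (Set.ncard_le_ncard ?_) (h₁.part_ncard_le x)
      rintro v ⟨hv | hv, hvx⟩
      · exact ⟨hv, by simpa [hc₁ v hv] using hvx⟩
      · simp [hc₂ v hv] at hvx
    · refine le_trans (Set.ncard_le_ncard ?_) (h₂.part_ncard_le x)
      rintro v ⟨hv | hv, hvx⟩
      · simp [hc₁ v hv] at hvx
      · exact ⟨hv, by simpa [hc₂ v hv] using hvx⟩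
  · rintro (x | x)
    · refine le_trans (Nat.add_le_add_right (le_trans
        (Set.ncard_le_ncard (t := Sum.inl '' {y | p₁ y = some x}) ?_)
        (Set.ncard_image_le (Set.toFinite _))) 1) (h₁.children_ncard_lt x)
      rintro (y | y) hy <;> simp [p] at hy
      exact ⟨y, hy, rfl⟩
    · refine le_trans (Nat.add_le_add_right (le_trans
        (Set.ncard_le_ncard (t := Sum.inr '' {y | p₂ y = some x}) ?_)
        (Set.ncard_image_le (Set.toFinite _))) 1) (h₂.children_ncard_lt x)
      rintro (y | y) hy <;> simp [p] at hy
      exact ⟨y, hy, rfl⟩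
  · intro u hu v hv huv
    rcases hadj u hu v hv huv with ⟨hu', hv'⟩ | ⟨hu', hv'⟩
    · rw [hc₁ u hu', hc₁ v hv']
      rcases h₁.part_adj u hu' v hv' huv with h | ⟨x, hx, hx'⟩ | ⟨x, hx, hx'⟩
      · exact Or.inl (by rw [h])
      · exact Or.inr (Or.inl ⟨Sum.inl x, by simp [hx], by simp [p, hx']⟩)
      · exact Or.inr (Or.inr ⟨Sum.inl x, by simp [hx], by simp [p, hx']⟩)
    · rw [hc₂ u hu', hc₂ v hv']
      rcases h₂.part_adj u hu' v hv' huv with h | ⟨x, hx, hx'⟩ | ⟨x, hx, hx'⟩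
      · exact Or.inl (by rw [h])
      · exact Or.inr (Or.inl ⟨Sum.inr x, by simp [hx], by simp [p, hx']⟩)
      · exact Or.inr (Or.inr ⟨Sum.inr x, by simp [hx], by simp [p, hx']⟩)
  · refine le_trans (Set.ncard_le_ncard
      (t := Sum.inl '' {y | p₁ y = none} ∪ Sum.inr '' {y | p₂ y = none}) ?_)
      ((Set.ncard_union_le _ _).trans (Nat.add_le_add
        (Set.ncard_image_le (Set.toFinite _)) (Set.ncard_image_le (Set.toFinite _))))
    rintro (y | y) hy <;> simp [p] at hy
    · exact Or.inl ⟨y, hy, rfl⟩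
    · exact Or.inr ⟨y, hy, rfl⟩

/-- A set `S` containing no vertex adjacent to a non-root part can be added as a new root above the
old one. -/
theorem IsRootedPartition.addRoot {V ι : Type*} [Finite V] [Finite ι]
    {G : SimpleGraph V} {W S : Set V} {p : ι → Option ι} {c : V → Option ι} {w D : ℕ}
    (hP : IsRootedPartition G (W \ S) p c w D)
    (hroot : ∃ v ∈ W \ S, c v = none)
    (hrootw : {v | v ∈ W \ S ∧ c v = none}.ncard ≤ w)
    (hrootD : {y | p y = none}.ncard + 1 ≤ D)
    (hN : ∀ u ∈ S, ∀ v ∈ W \ S, G.Adj u v → c v = none) :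
    ∃ (p' : Option ι → Option (Option ι)) (c' : V → Option (Option ι)),
      IsRootedPartition G W p' c' w D ∧ (∀ v, c' v = none ↔ v ∈ S) ∧
      {y | p' y = none}.ncard ≤ 1 := by
  classical
  obtain ⟨r, hr⟩ := hP.rank
  let p' : Option ι → Option (Option ι) := fun a => a.map p
  let c' : V → Option (Option ι) := fun v => if v ∈ S then none else some (c v)
  have hcS : ∀ v ∈ S, c' v = none := fun v hv => if_pos hv
  have hcW : ∀ v, v ∉ S → c' v = some (c v) := fun v hv => if_neg hv
  have hcS' : ∀ v a, c' v = some a → v ∉ S ∧ c v = a := by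
    intro v a h
    by_cases hv : v ∈ S
    · simp [hcS v hv] at h
    · exact ⟨hv, by simpa [hcW v hv] using h⟩
  refine ⟨p', c', ⟨⟨fun a => a.elim 0 (fun x => r x + 1), ?_⟩, ?_, ?_, ?_, ?_⟩, ?_, ?_⟩
  · rintro (_ | x) (_ | y) hxy <;> simp [p'] at hxy ⊢
    exact hr x y hxy
  · rintro (_ | x)
    · obtain ⟨v, hv, hvx⟩ := hroot
      exact ⟨v, hv.1, by rw [hcW v hv.2, hvx]⟩
    · obtain ⟨v, hv, hvx⟩ := hP.part_nonempty x
      exact ⟨v, hv.1, by rw [hcW v hv.2, hvx]⟩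
  · have key : ∀ a, {v | v ∈ W ∧ c' v = some a} ⊆ {v | v ∈ W \ S ∧ c v = a} := by
      rintro a v ⟨hv, hva⟩
      exact ⟨⟨hv, (hcS' v a hva).1⟩, (hcS' v a hva).2⟩
    rintro (_ | x)
    · exact (Set.ncard_le_ncard (key _)).trans hrootw
    · exact (Set.ncard_le_ncard (key _)).trans (hP.part_ncard_le x)
  · have key : ∀ a, {y | p' y = some a} ⊆ some '' {y | p y = a} := by
      rintro a (_ | y) hy <;> simp [p'] at hy
      exact ⟨y, hy, rfl⟩
    have key' : ∀ a, {y | p' y = some a}.ncard ≤ {y | p y = a}.ncard := fun a =>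
      (Set.ncard_le_ncard (key a)).trans (Set.ncard_image_le (Set.toFinite _))
    rintro (_ | x)
    · exact (Nat.add_le_add_right (key' _) 1).trans hrootD
    · exact (Nat.add_le_add_right (key' _) 1).trans (hP.children_ncard_lt x)
  · intro u hu v hv huv
    by_cases huS : u ∈ S <;> by_cases hvS : v ∈ S
    · exact Or.inl (by rw [hcS u huS, hcS v hvS])
    · refine Or.inr (Or.inr ⟨none, ?_, by rw [hcS u huS]; rfl⟩)
      rw [hcW v hvS, hN u huS v ⟨hv, hvS⟩ huv]
    · refine Or.inr (Or.inl ⟨none, ?_, by rw [hcS v hvS]; rfl⟩)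
      rw [hcW u huS, hN v hvS u ⟨hu, huS⟩ huv.symm]
    · rw [hcW u huS, hcW v hvS]
      rcases hP.part_adj u ⟨hu, huS⟩ v ⟨hv, hvS⟩ huv with h | ⟨x, hx, hx'⟩ | ⟨x, hx, hx'⟩
      · exact Or.inl (by rw [h])
      · exact Or.inr (Or.inl ⟨some x, by simp [hx], by simp [p', hx']⟩)
      · exact Or.inr (Or.inr ⟨some x, by simp [hx], by simp [p', hx']⟩)
  · intro v
    by_cases hv : v ∈ S <;> simp [hcS, hcW, hv]
  · refine (Set.ncard_le_ncard (t := {none}) ?_).trans (Set.ncard_singleton _).le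
    rintro (_ | y) hy
    · rfl
    · simp [p'] at hy

/-- If no value of `f` is taken by more than half of `S`, then the values can be split into two
groups, each accounting for at most two thirds of `S`. -/
theorem exists_balanced_grouping {V C : Type*} [Finite C] [DecidableEq C] (S : Finset V)
    (f : V → C) (M : ℕ) (hM : S.card ≤ M) (hf : ∀ a, 2 * (S.filter (f · = a)).card ≤ M) :
    ∃ P : Finset C, 3 * (S.filter (f · ∈ P)).card ≤ 2 * M ∧
      3 * (S.filter (f · ∉ P)).card ≤ 2 * M := by
  classical
  have hsplit : ∀ P : Finset C,
      (S.filter (f · ∈ P)).card + (S.filter (f · ∉ P)).card = S.card := fun P =>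
    Finset.card_filter_add_card_filter_not _
  by_cases hbig : ∃ a, M ≤ 3 * (S.filter (f · = a)).card
  · obtain ⟨a, ha⟩ := hbig
    refine ⟨{a}, ?_⟩
    have h₁ := hsplit {a}
    have h₂ := hf a
    simp only [Finset.mem_singleton] at h₁ ⊢
    omega
  · push Not at hbig
    obtain ⟨P, hP⟩ := Set.Finite.exists_maximal
      (s := {P : Finset C | 3 * (S.filter (f · ∈ P)).card ≤ 2 * M})
      (Set.toFinite _) ⟨∅, by simp⟩
    refine ⟨P, hP.prop, ?_⟩
    by_contra hlt
    have hne : (S.filter (f · ∉ P)).Nonempty := by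
      rw [← Finset.card_pos]
      omega
    obtain ⟨v, hv⟩ := hne
    have hvP : f v ∉ P := (Finset.mem_filter.1 hv).2
    refine hvP (hP.le_of_ge (y := insert (f v) P) ?_ (Finset.subset_insert _ _)
      (Finset.mem_insert_self _ _))
    have hle : (S.filter (f · ∈ insert (f v) P)).card ≤
        (S.filter (f · = f v)).card + (S.filter (f · ∈ P)).card := by
      refine le_trans (Finset.card_le_card ?_) (Finset.card_union_le _ _)
      intro u hu
      simp only [Finset.mem_filter, Finset.mem_insert, Finset.mem_union] at hu ⊢
      tauto
    have h₁ := hsplit P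
    have h₂ := hbig (f v)
    simp only [Set.mem_ofPred_eq]
    omega

/-- The graph obtained from `T` by isolating the node `t`. -/
def isolateNode {ι : Type*} (T : SimpleGraph ι) (t : ι) : SimpleGraph ι where
  Adj x y := T.Adj x y ∧ x ≠ t ∧ y ≠ t
  symm := ⟨fun _ _ h => ⟨h.1.symm, h.2.2, h.2.1⟩⟩
  loopless := ⟨fun _ h => h.1.ne rfl⟩

theorem exists_adj_dist_add_one {ι : Type*} {T : SimpleGraph ι} (hT : T.Connected) {t s : ι}
    (hs : s ≠ t) :
    ∃ y, T.Adj t y ∧ T.dist y s + 1 = T.dist t s ∧ (isolateNode T t).Reachable y s := by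
  obtain ⟨q, hq⟩ := hT.exists_walk_length_eq_dist t s
  have hpath := q.isPath_of_length_eq_dist hq
  cases q with
  | nil => exact absurd rfl hs
  | @cons _ y _ h q =>
    have hqt : t ∉ q.support := ((Walk.cons_isPath_iff h q).1 hpath).2
    refine ⟨y, h, ?_, ⟨q.transfer (isolateNode T t) ?_⟩⟩
    · refine le_antisymm ?_ ?_
      · rw [← hq, Walk.length_cons]
        exact Nat.add_le_add_right (dist_le q) 1
      · have := hT.dist_triangle (u := t) (v := y) (w := s)
        rw [dist_eq_one_iff_adj.2 h] at this
        omega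
    · intro e he
      induction e using Sym2.ind with
      | _ a b =>
        refine ⟨q.adj_of_mem_edges he, ?_, ?_⟩
        · rintro rfl
          exact hqt (q.fst_mem_support_of_mem_edges he)
        · rintro rfl
          exact hqt (q.snd_mem_support_of_mem_edges he)

/-- Two neighbours of `t` in the same component of `T - t` are equal if `T` is acyclic. -/
theorem eq_of_adj_of_reachable_isolateNode {ι : Type*} {T : SimpleGraph ι} (hT : T.IsAcyclic)
    {t y z : ι} (hy : T.Adj t y) (hz : T.Adj t z) (hyz : (isolateNode T t).Reachable y z) :
    y = z := by
  by_contra hne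
  have hb := isAcyclic_iff_forall_adj_isBridge.1 hT hy
  rw [isBridge_iff] at hb
  refine hb ?_
  have hle : isolateNode T t ≤ T \ fromEdgeSet {s(t, y)} := by
    intro a b hab
    refine ⟨hab.1, fun h => ?_⟩
    have h' : s(a, b) = s(t, y) := h.1
    rcases Sym2.eq_iff.1 h' with h' | h'
    · exact hab.2.1 h'.1
    · exact hab.2.2 h'.2
  have hadj : (T \ fromEdgeSet {s(t, y)}).Adj t z := by
    refine ⟨hz, fun h => ?_⟩
    have h' : s(t, z) = s(t, y) := h.1
    rcases Sym2.eq_iff.1 h' with h' | h'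
    · exact hne h'.2.symm
    · exact hy.ne h'.1
  exact hadj.reachable.trans (hyz.mono hle).symm

/-- A weighted tree has a node whose removal leaves components of at most half the weight. -/
theorem exists_centroid {V ι : Type*} [Finite ι] {T : SimpleGraph ι} (hT : T.IsTree)
    (S : Finset V) (τ : V → ι) :
    ∃ t, ∀ F ⊆ S, (∀ v ∈ F, τ v ≠ t) →
      (∀ u ∈ F, ∀ v ∈ F, (isolateNode T t).Reachable (τ u) (τ v)) → 2 * F.card ≤ S.card := by
  classical
  have : Nonempty ι := hT.connected.nonempty
  obtain ⟨t, ht⟩ := Finite.exists_min fun t => ∑ v ∈ S, T.dist t (τ v)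
  refine ⟨t, fun F hFS hFt hF => ?_⟩
  rcases F.eq_empty_or_nonempty with rfl | ⟨u, hu⟩
  · simp
  obtain ⟨y, hty, -, hyu⟩ := exists_adj_dist_add_one hT.connected (hFt u hu)
  have hnear : ∀ v ∈ F, T.dist y (τ v) + 1 = T.dist t (τ v) := by
    intro v hv
    obtain ⟨z, htz, hz, hzv⟩ := exists_adj_dist_add_one hT.connected (hFt v hv)
    rwa [eq_of_adj_of_reachable_isolateNode hT.isAcyclic hty htz
      ((hyu.trans (hF u hu v hv)).trans hzv.symm)]
  have hfar : ∀ v, T.dist y (τ v) ≤ T.dist t (τ v) + 1 := by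
    intro v
    have := hT.connected.dist_triangle (u := y) (v := t) (w := τ v)
    rw [dist_eq_one_iff_adj.2 hty.symm] at this
    omega
  have hsum : ∑ v ∈ S, (T.dist y (τ v) + if v ∈ F then 2 else 0) ≤
      ∑ v ∈ S, (T.dist t (τ v) + 1) := by
    refine Finset.sum_le_sum fun v _ => ?_
    split_ifs with hv
    · have := hnear v hv
      omega
    · have := hfar v
      omega
  have hcard : ∑ v ∈ S, (if v ∈ F then 2 else 0) = 2 * F.card := by
    rw [← Finset.sum_filter, Finset.sum_const, Finset.filter_mem_eq_inter,
      Finset.inter_eq_right.2 hFS, smul_eq_mul, mul_comm]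
  rw [Finset.sum_add_distrib, Finset.sum_add_distrib, hcard, Finset.sum_const, smul_eq_mul,
    mul_one] at hsum
  have := ht y
  omega

theorem IsTreeDecomp.hasBalancedSeparation {V ι : Type*} [Finite V] [Finite ι]
    {G : SimpleGraph V} {T : SimpleGraph ι} {B : ι → Set V} (hB : IsTreeDecomp G T B) {k : ℕ}
    (hk : ∀ x, (B x).ncard ≤ k) (S : Set V) : HasBalancedSeparation G k S := by
  classical
  have := Fintype.ofFinite V
  have hτ : ∀ v, ∃ x, v ∈ B x := fun v => by
    obtain ⟨x⟩ := (hB.subtree v).nonempty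
    exact ⟨x.1, x.2⟩
  choose τ hτ using hτ
  obtain ⟨t, ht⟩ := exists_centroid hB.isTree S.toFinset τ
  have hreach : ∀ v, v ∉ B t → ∀ x y, v ∈ B x → v ∈ B y → (isolateNode T t).Reachable x y := by
    intro v hv x y hx hy
    refine ((hB.subtree v).preconnected ⟨x, hx⟩ ⟨y, hy⟩).map
      (⟨Subtype.val, fun {a b} hab => ⟨hab, ?_, ?_⟩⟩ :
        T.induce {x | v ∈ B x} →g isolateNode T t)
    · exact fun h => hv (h ▸ a.2)
    · exact fun h => hv (h ▸ b.2)
  let f : V → (isolateNode T t).ConnectedComponent :=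
    fun v => (isolateNode T t).connectedComponentMk (τ v)
  obtain ⟨P, hP₁, hP₂⟩ := exists_balanced_grouping (S.toFinset.filter (· ∉ B t)) f S.ncard
    (by
      rw [Set.ncard_eq_toFinset_card']
      exact Finset.card_filter_le _ _)
    (fun a => by
      rw [Set.ncard_eq_toFinset_card']
      refine ht _ ((Finset.filter_subset _ _).trans (Finset.filter_subset _ _)) ?_ ?_
      · intro v hv hvt
        exact (Finset.mem_filter.1 (Finset.mem_filter.1 hv).1).2 (hvt ▸ hτ v)
      · intro u hu v hv
        exact ConnectedComponent.exact
          ((Finset.mem_filter.1 hu).2.trans (Finset.mem_filter.1 hv).2.symm))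
  refine ⟨B t, {v | v ∉ B t ∧ f v ∈ P}, {v | v ∉ B t ∧ f v ∉ P}, hk t, ?_, ?_, ?_, ?_, ?_, ?_, ?_⟩
  · intro v
    simp only [Set.mem_ofPred_eq]
    tauto
  · exact Set.disjoint_left.2 fun v hv hv' => hv'.1 hv
  · exact Set.disjoint_left.2 fun v hv hv' => hv'.1 hv
  · exact Set.disjoint_left.2 fun v hv hv' => hv'.2 hv.2
  · intro u hu v hv huv
    obtain ⟨x, hux, hvx⟩ := hB.edge_mem huv
    have : f u = f v := ConnectedComponent.sound
      ((hreach u hu.1 _ x (hτ u) hux).trans (hreach v hv.1 x _ hvx (hτ v)))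
    exact hv.2 (this ▸ hu.2)
  · convert hP₁ using 2
    rw [Set.ncard_eq_toFinset_card']
    congr 1
    ext v
    simp [and_assoc]
  · convert hP₂ using 2
    rw [Set.ncard_eq_toFinset_card']
    congr 1
    ext v
    simp [and_assoc]

theorem exists_isTreeDecomp_treewidth {V : Type} [Fintype V] (G : SimpleGraph V) :
    ∃ (ι : Type) (_ : Fintype ι) (T : SimpleGraph ι) (B : ι → Set V),
      IsTreeDecomp G T B ∧ ∀ x, (B x).ncard ≤ treewidth G + 1 := by
  refine Nat.sInf_mem (s := {k | ∃ (ι : Type) (_ : Fintype ι) (T : SimpleGraph ι)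
    (B : ι → Set V), IsTreeDecomp G T B ∧ ∀ x, (B x).ncard ≤ k + 1})
    ⟨(Set.univ : Set V).ncard, Unit, inferInstance, ⊥, fun _ => Set.univ,
      ⟨IsTree.of_subsingleton, fun _ _ _ => ⟨(), trivial, trivial⟩, fun v => ?_⟩,
      fun _ => Nat.le_succ _⟩
  have : Nonempty {x : Unit | v ∈ (Set.univ : Set V)} := ⟨⟨(), trivial⟩⟩
  exact { preconnected := fun a b => Subsingleton.elim a b ▸ Reachable.refl _ }

theorem ncard_neighborSet_le_maxDeg {V : Type*} [Fintype V] (G : SimpleGraph V) (v : V) :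
    (G.neighborSet v).ncard ≤ maxDeg G :=
  le_csSup (Set.finite_range _).bddAbove ⟨v, rfl⟩

theorem ncard_exists_adj_le {V : Type*} [Finite V] {G : SimpleGraph V} {d : ℕ}
    (hd : ∀ v, (G.neighborSet v).ncard ≤ d) (S : Set V) :
    {v | ∃ u ∈ S, G.Adj u v}.ncard ≤ S.ncard * d := by
  induction S, Set.toFinite S using Set.Finite.induction_on with
  | empty => simp
  | @insert a S ha hS ih =>
    have hsub : {v | ∃ u ∈ insert a S, G.Adj u v} ⊆
        {v | ∃ u ∈ S, G.Adj u v} ∪ G.neighborSet a := by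
      rintro v ⟨u, rfl | hu, huv⟩
      · exact Or.inr huv
      · exact Or.inl ⟨u, hu, huv⟩
    calc _ ≤ _ := Set.ncard_le_ncard hsub
      _ ≤ _ := Set.ncard_union_le _ _
      _ ≤ S.ncard * d + d := Nat.add_le_add ih (hd a)
      _ = _ := by rw [Set.ncard_insert_of_notMem ha hS, Nat.succ_mul]

/-- A rooted partition of `W` with small parts and few children, with all of `S` in the root part,
and with the size and the number of children of the root bounded in terms of `|S|`. -/
def HasRootedPartition {V : Type} (G : SimpleGraph V) (k d : ℕ) (W S : Set V) : Prop :=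
  ∃ (ι : Type) (_ : Fintype ι) (p : ι → Option ι) (c : V → Option ι),
    IsRootedPartition G W p c (2 * k * (9 * d - 1)) (6 * d) ∧
    (∀ v ∈ S, c v = none) ∧
    2 * {v | v ∈ W ∧ c v = none}.ncard + 4 * k ≤ 3 * S.ncard ∧
    2 * k * ({y | p y = none}.ncard + 1) ≤ S.ncard

section
variable {V : Type} [Finite V] {G : SimpleGraph V} {k d : ℕ} {W S : Set V}

/-- If few vertices lie outside `S`, they form a single part attached to the root. -/
theorem hasRootedPartition_of_ncard_diff_le (hd : 1 ≤ d) (hS : 4 * k ≤ S.ncard)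
    (hle : (W \ S).ncard ≤ 2 * k * (9 * d - 1)) :
    HasRootedPartition G k d W S := by
  classical
  rcases (W \ S).eq_empty_or_nonempty with hempty | ⟨w, hw⟩
  · refine ⟨Empty, inferInstance, fun _ => none, fun _ => none,
      isRootedPartition_of_isEmpty _ _ _ _ _ _, fun _ _ => rfl, ?_, ?_⟩
    · have : {v | v ∈ W ∧ (none : Option Empty) = none}.ncard ≤ S.ncard :=
        Set.ncard_le_ncard fun v hv => Set.sdiff_eq_empty.1 hempty hv.1
      beta_reduce
      omega
    · have : {y : Empty | (none : Option Empty) = none}.ncard = 0 := by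
        rw [Set.eq_empty_of_isEmpty {y : Empty | (none : Option Empty) = none}, Set.ncard_empty]
      rw [this]
      omega
  · let c : V → Option Unit := fun v => if v ∈ S then none else some ()
    have hc : ∀ v, c v = none ↔ v ∈ S := fun v => by simp [c]
    have hc' : ∀ v x, c v = some x ↔ v ∉ S := fun v x => by simp [c]
    refine ⟨Unit, inferInstance, fun _ => none, c,
      ⟨⟨fun _ => 0, fun x y h => by cases h⟩, fun x => ⟨w, hw.1, (hc' w x).2 hw.2⟩, ?_, ?_, ?_⟩,
      fun v hv => (hc v).2 hv, ?_, ?_⟩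
    · intro x
      refine (Set.ncard_le_ncard ?_).trans hle
      exact fun v hv => ⟨hv.1, (hc' v x).1 hv.2⟩
    · intro x
      simp
      omega
    · intro u _ v _ _
      cases hu : c u <;> cases hv : c v <;> simp
    · have : {v | v ∈ W ∧ c v = none}.ncard ≤ S.ncard :=
        Set.ncard_le_ncard fun v hv => (hc v).1 hv.2
      omega
    · have : {y : Unit | (none : Option Unit) = none}.ncard ≤ 1 :=
        (Set.ncard_le_card _).trans (by simp)
      nlinarith

/-- If `S` is small, put its outer neighbourhood in the root part of a partition of `W \ S`, and add
`S` as a new root. -/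
theorem hasRootedPartition_of_ncard_le (hk : 1 ≤ k) (hd : 1 ≤ d)
    (hdeg : ∀ v, (G.neighborSet v).ncard ≤ d) (hS : 4 * k ≤ S.ncard) (hS' : S.ncard ≤ 12 * k)
    (hlt : 2 * k * (9 * d - 1) < (W \ S).ncard)
    (ih : ∀ S' ⊆ W \ S, 4 * k ≤ S'.ncard → S'.ncard ≤ 12 * k * d →
      HasRootedPartition G k d (W \ S) S') :
    HasRootedPartition G k d W S := by
  obtain ⟨e, rfl⟩ : ∃ e, d = e + 1 := ⟨d - 1, by omega⟩
  have he : 9 * (e + 1) - 1 = 9 * e + 8 := by omega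
  have hN : {v | v ∈ W \ S ∧ ∃ u ∈ S, G.Adj u v}.ncard ≤ 12 * k * (e + 1) :=
    calc _ ≤ _ := Set.ncard_le_ncard fun v hv => hv.2
      _ ≤ _ := ncard_exists_adj_le hdeg S
      _ ≤ _ := Nat.mul_le_mul_right _ hS'
  obtain ⟨S', hNS', hS'W, hS'4, hS'12⟩ : ∃ S', {v | v ∈ W \ S ∧ ∃ u ∈ S, G.Adj u v} ⊆ S' ∧
      S' ⊆ W \ S ∧ 4 * k ≤ S'.ncard ∧ S'.ncard ≤ 12 * k * (e + 1) := by
    by_cases h : 4 * k ≤ {v | v ∈ W \ S ∧ ∃ u ∈ S, G.Adj u v}.ncard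
    · exact ⟨_, subset_rfl, fun v hv => hv.1, h, hN⟩
    · obtain ⟨S', h₁, h₂, h₃⟩ := Set.exists_subsuperset_card_eq
        (s := {v | v ∈ W \ S ∧ ∃ u ∈ S, G.Adj u v}) (t := W \ S) (n := 4 * k)
        (fun v hv => hv.1) (by omega) (by rw [he] at hlt; nlinarith)
      exact ⟨S', h₁, h₂, h₃.ge, by nlinarith⟩
  obtain ⟨ι, _, p, c, hP, hc, hw, hD⟩ := ih S' hS'W hS'4 hS'12
  have hne : S'.Nonempty := by
    rw [← Set.ncard_pos]
    omega
  obtain ⟨s, hs⟩ := hne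
  obtain ⟨p', c', hP', hc', hD'⟩ := hP.addRoot ⟨s, hS'W hs, hc s hs⟩
    (by rw [he]; nlinarith)
    (by
      have : 2 * k * ({y | p y = none}.ncard + 1) ≤ 2 * k * (6 * (e + 1)) := by nlinarith
      exact Nat.le_of_mul_le_mul_left this (by omega))
    (fun u hu v hv huv => hc v (hNS' ⟨hv, u, hu, huv⟩))
  refine ⟨Option ι, inferInstance, p', c', hP', fun v hv => (hc' v).2 hv, ?_, ?_⟩
  · have : {v | v ∈ W ∧ c' v = none}.ncard ≤ S.ncard :=
      Set.ncard_le_ncard fun v hv => (hc' v).1 hv.2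
    omega
  · nlinarith

/-- If `S` is large, split it along a balanced separation and glue the partitions of the two
sides. -/
theorem hasRootedPartition_of_hasBalancedSeparation (hk : 1 ≤ k) (hd : 1 ≤ d)
    (hsep : HasBalancedSeparation G k S) (hSW : S ⊆ W) (hS : 12 * k < S.ncard)
    (hS' : S.ncard ≤ 12 * k * d)
    (ih : ∀ W' ⊂ W, ∀ S' ⊆ W', 4 * k ≤ S'.ncard → S'.ncard ≤ 12 * k * d →
      HasRootedPartition G k d W' S') :
    HasRootedPartition G k d W S := by
  obtain ⟨X, A₁, A₂, hX, hcov, hXA₁, hXA₂, hAA, hadj, hA₁, hA₂⟩ := hsep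
  have hk12 : 12 * k ≤ 12 * k * d := Nat.le_mul_of_pos_right _ hd
  have hXW : (X ∩ W).ncard ≤ k := (Set.ncard_le_ncard Set.inter_subset_left).trans hX
  have hSX : (S ∩ X).ncard ≤ (X ∩ W).ncard :=
    Set.ncard_le_ncard fun v hv => ⟨hv.2, hSW hv.1⟩
  have hdisj : ∀ A, Disjoint X A → Disjoint (S ∩ A) (X ∩ W) := fun A hA =>
    hA.symm.mono Set.inter_subset_right Set.inter_subset_left
  have hcard₁ : (S ∩ A₁ ∪ X ∩ W).ncard = (S ∩ A₁).ncard + (X ∩ W).ncard :=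
    Set.ncard_union_eq (hdisj A₁ hXA₁)
  have hcard₂ : (S ∩ A₂ ∪ X ∩ W).ncard = (S ∩ A₂).ncard + (X ∩ W).ncard :=
    Set.ncard_union_eq (hdisj A₂ hXA₂)
  have hcardS : S.ncard = (S ∩ X).ncard + (S ∩ A₁).ncard + (S ∩ A₂).ncard := by
    rw [← Set.ncard_union_eq (hXA₁.mono Set.inter_subset_right Set.inter_subset_right),
      ← Set.ncard_union_eq]
    · congr 1
      ext v
      have := hcov v
      simp only [Set.mem_union, Set.mem_inter_iff]
      tauto
    · exact (hXA₂.sup_left hAA).mono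
        (sup_le_sup Set.inter_subset_right Set.inter_subset_right) Set.inter_subset_right
  have hpos : ∀ A, 0 < (S ∩ A).ncard → ∃ v ∈ W, v ∈ A := fun A hA => by
    obtain ⟨v, hv⟩ := (Set.ncard_pos).1 hA
    exact ⟨v, hSW hv.1, hv.2⟩
  obtain ⟨a₁, ha₁W, ha₁⟩ := hpos A₁ (by omega)
  obtain ⟨a₂, ha₂W, ha₂⟩ := hpos A₂ (by omega)
  obtain ⟨ι₁, _, p₁, c₁, hP₁, hc₁, hw₁, hD₁⟩ := ih (A₁ ∩ W ∪ X ∩ W)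
    ((Set.ssubset_iff_of_subset (Set.union_subset Set.inter_subset_right
      Set.inter_subset_right)).2 ⟨a₂, ha₂W, fun h => h.elim
        (fun h => Set.disjoint_left.1 hAA h.1 ha₂) (fun h => Set.disjoint_left.1 hXA₂ h.1 ha₂)⟩)
    (S ∩ A₁ ∪ X ∩ W)
    (Set.union_subset_union_left _ fun v hv => ⟨hv.2, hSW hv.1⟩) (by omega) (by omega)
  obtain ⟨ι₂, _, p₂, c₂, hP₂, hc₂, hw₂, hD₂⟩ := ih (A₂ ∩ W ∪ X ∩ W)
    ((Set.ssubset_iff_of_subset (Set.union_subset Set.inter_subset_right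
      Set.inter_subset_right)).2 ⟨a₁, ha₁W, fun h => h.elim
        (fun h => Set.disjoint_left.1 hAA ha₁ h.1) (fun h => Set.disjoint_left.1 hXA₁ h.1 ha₁)⟩)
    (S ∩ A₂ ∪ X ∩ W)
    (Set.union_subset_union_left _ fun v hv => ⟨hv.2, hSW hv.1⟩) (by omega) (by omega)
  have hinter : (A₁ ∩ W ∪ X ∩ W) ∩ (A₂ ∩ W ∪ X ∩ W) ⊆ X ∩ W := by
    rintro v ⟨h₁ | h₁, h₂ | h₂⟩
    · exact absurd h₂.1 (Set.disjoint_left.1 hAA h₁.1)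
    all_goals assumption
  have hWeq : W = (A₁ ∩ W ∪ X ∩ W) ∪ (A₂ ∩ W ∪ X ∩ W) := by
    refine Set.Subset.antisymm (fun v hv => ?_) ?_
    · rcases hcov v with h | h | h
      exacts [Or.inl (Or.inr ⟨h, hv⟩), Or.inl (Or.inl ⟨h, hv⟩), Or.inr (Or.inl ⟨h, hv⟩)]
    · rintro v ((h | h) | (h | h)) <;> exact h.2
  obtain ⟨p, c, hP, hcW₁, hcW₂, hD⟩ := hP₁.glue hP₂ hWeq
    (fun v hv => hc₁ v (Or.inr (hinter hv))) (fun v hv => hc₂ v (Or.inr (hinter hv)))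
    (by
      intro u hu v hv huv
      rcases hcov u with h | h | h <;> rcases hcov v with h' | h' | h'
      exacts [Or.inl ⟨Or.inr ⟨h, hu⟩, Or.inr ⟨h', hv⟩⟩,
        Or.inl ⟨Or.inr ⟨h, hu⟩, Or.inl ⟨h', hv⟩⟩,
        Or.inr ⟨Or.inr ⟨h, hu⟩, Or.inl ⟨h', hv⟩⟩,
        Or.inl ⟨Or.inl ⟨h, hu⟩, Or.inr ⟨h', hv⟩⟩,
        Or.inl ⟨Or.inl ⟨h, hu⟩, Or.inl ⟨h', hv⟩⟩,
        (hadj u h v h' huv).elim,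
        Or.inr ⟨Or.inl ⟨h, hu⟩, Or.inr ⟨h', hv⟩⟩,
        (hadj v h' u h huv.symm).elim,
        Or.inr ⟨Or.inl ⟨h, hu⟩, Or.inl ⟨h', hv⟩⟩])
  refine ⟨ι₁ ⊕ ι₂, inferInstance, p, c, hP, ?_, ?_, ?_⟩
  · intro v hv
    rcases hcov v with h | h | h
    · rw [hcW₁ v (Or.inr ⟨h, hSW hv⟩), hc₁ v (Or.inr ⟨h, hSW hv⟩)]
      rfl
    · rw [hcW₁ v (Or.inl ⟨h, hSW hv⟩), hc₁ v (Or.inl ⟨hv, h⟩)]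
      rfl
    · rw [hcW₂ v (Or.inl ⟨h, hSW hv⟩), hc₂ v (Or.inl ⟨hv, h⟩)]
      rfl
  · have hsub : {v | v ∈ W ∧ c v = none} ⊆ {v | v ∈ A₁ ∩ W ∪ X ∩ W ∧ c₁ v = none} ∪
        ({v | v ∈ A₂ ∩ W ∪ X ∩ W ∧ c₂ v = none} \ (X ∩ W)) := by
      rintro v ⟨hv, hcv⟩
      by_cases hv₁ : v ∈ A₁ ∩ W ∪ X ∩ W
      · exact Or.inl ⟨hv₁, by simpa [hcW₁ v hv₁] using hcv⟩
      · have hv₂ : v ∈ A₂ ∩ W ∪ X ∩ W := (hWeq.subset hv).resolve_left hv₁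
        exact Or.inr ⟨⟨hv₂, by simpa [hcW₂ v hv₂] using hcv⟩, fun h => hv₁ (Or.inr h)⟩
    have h₁ := (Set.ncard_le_ncard hsub).trans (Set.ncard_union_le _ _)
    have h₂ := Set.ncard_sdiff_add_ncard_of_subset
      (show X ∩ W ⊆ {v | v ∈ A₂ ∩ W ∪ X ∩ W ∧ c₂ v = none} from
        fun v hv => ⟨Or.inr hv, hc₂ v (Or.inr hv)⟩)
    omega
  · have : 2 * k * ({y | p y = none}.ncard + 1) ≤
        2 * k * ({y | p₁ y = none}.ncard + {y | p₂ y = none}.ncard + 1) :=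
      Nat.mul_le_mul_left _ (Nat.add_le_add_right hD 1)
    have : (S ∩ A₁ ∪ X ∩ W).ncard + (S ∩ A₂ ∪ X ∩ W).ncard ≤ S.ncard + 2 * k := by omega
    linarith

end

theorem hasRootedPartition {V : Type} [Finite V] {G : SimpleGraph V} {k d : ℕ} (hk : 1 ≤ k)
    (hd : 1 ≤ d) (hdeg : ∀ v, (G.neighborSet v).ncard ≤ d)
    (hsep : ∀ S, HasBalancedSeparation G k S) (W : Set V) :
    ∀ S ⊆ W, 4 * k ≤ S.ncard → S.ncard ≤ 12 * k * d → HasRootedPartition G k d W S := by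
  induction W using (wellFounded_lt (α := Set V)).induction with
  | _ W ih =>
  intro S hSW hS hS'
  rcases le_or_gt (W \ S).ncard (2 * k * (9 * d - 1)) with hle | hlt
  · exact hasRootedPartition_of_ncard_diff_le hd hS hle
  rcases le_or_gt S.ncard (12 * k) with hsmall | hbig
  · refine hasRootedPartition_of_ncard_le hk hd hdeg hS hsmall hlt (ih _ ?_)
    obtain ⟨s, hs⟩ := (Set.ncard_pos (s := S)).1 (by omega)
    exact (Set.ssubset_iff_of_subset Set.sdiff_subset).2 ⟨s, hSW hs, fun h => h.2 hs⟩
  · exact hasRootedPartition_of_hasBalancedSeparation hk hd (hsep S) hSW hbig hS' ih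

/-- Every non-trivial graph `G` has a `T`-partition of width at most
`2·(tw(G)+1)·(9·Δ(G) − 1)` for some tree `T` with `Δ(T) ≤ 6·Δ(G)`. -/
theorem exists_treePartition_improved {V : Type} [Fintype V] (G : SimpleGraph V)
    (hG : G.edgeSet.Nonempty) :
    ∃ (ι : Type) (_ : Fintype ι) (T : SimpleGraph ι) (B : ι → Set V),
      IsTreePartition G T B ∧
      (∀ x, (B x).ncard ≤ 2 * (treewidth G + 1) * (9 * maxDeg G - 1)) ∧
      (∀ x, (T.neighborSet x).ncard ≤ 6 * maxDeg G) := by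
  obtain ⟨u, v, huv⟩ : ∃ u v, G.Adj u v := by
    obtain ⟨e, he⟩ := hG
    induction e using Sym2.ind with
    | _ u v => exact ⟨u, v, he⟩
  have hd : 1 ≤ maxDeg G :=
    ((Set.ncard_pos (s := G.neighborSet u)).2 ⟨v, huv⟩).trans_le (ncard_neighborSet_le_maxDeg G u)
  obtain ⟨κ, _, T, B, hB, hBw⟩ := exists_isTreeDecomp_treewidth G
  have hk : 1 ≤ treewidth G + 1 := Nat.le_add_left _ _
  generalize treewidth G + 1 = k at *
  have hdeg := ncard_neighborSet_le_maxDeg G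
  generalize maxDeg G = d at *
  have hwidth : 16 * k ≤ 2 * k * (9 * d - 1) := by
    have : 8 ≤ 9 * d - 1 := by omega
    nlinarith
  rcases lt_or_ge (Set.univ : Set V).ncard (4 * k) with hlt | hge
  · refine (isRootedPartition_of_isEmpty G Set.univ (fun _ : Empty => none) (fun _ => none)
      _ _).exists_treePartition ⟨u, rfl⟩ ?_ ?_
    · have := Set.ncard_le_ncard (Set.subset_univ {v : V | (none : Option Empty) = none})
      omega
    · rw [Set.eq_empty_of_isEmpty {y : Empty | (none : Option Empty) = none}, Set.ncard_empty]
      omega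
  · obtain ⟨S, -, hS⟩ := Set.exists_subset_card_eq hge
    obtain ⟨ι, _, p, c, hP, hc, hw, hD⟩ := hasRootedPartition hk hd hdeg
      (fun S => hB.hasBalancedSeparation hBw S) Set.univ S (Set.subset_univ _) hS.ge
      (by nlinarith)
    obtain ⟨s, hs⟩ := (Set.ncard_pos (s := S)).1 (by omega)
    refine hP.exists_treePartition ⟨s, hc s hs⟩ ?_ ?_
    · simp only [Set.mem_univ, true_and] at hw
      omega
    · have : 2 * k * ({y | p y = none}.ncard + 1) ≤ 2 * k * (6 * d) := by nlinarith
      have := Nat.le_of_mul_le_mul_left this (by omega)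
      omega
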